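/- Let h and k be positive integers. The set of vectors (a_1, …, a_k) ∈ ℝ^k whose coordinates are pairwise distinct and such that the k-element set {a_1, …, a_k} is not an h-Sidon set of real numbers has k-dimensional Lebesgue measure zero. In particular, almost all k-element sets of real numbers are h-Sidon sets. -/

import Mathlib

/-- A subset `A` of an additive abelian group is an `h`-Sidon set if whenever two
multisets of cardinality `h` with elements in `A` have equal sums, they are equal. -/
def IsSidonSet {G : Type*} [AddCommGroup G] (h : ℕ) (A : Set G) : Prop :=
  ∀ s t : Multiset G, (∀ x ∈ s, x ∈ A) → (∀ x ∈ t, x ∈ A) →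
    Multiset.card s = h → Multiset.card t = h → s.sum = t.sum → s = t

open MeasureTheory

/-- The vectors on whose coordinates the multisets of indices `s` and `t` have equal sums. -/
def equalSumSubmodule {ι : Type*} (s t : Multiset ι) : Submodule ℝ (ι → ℝ) where
  carrier := {a | (s.map a).sum = (t.map a).sum}
  zero_mem' := by simp
  add_mem' {a b} ha hb := by
    simp only [Set.mem_ofPred_eq, Pi.add_apply, Multiset.sum_map_add] at ha hb ⊢
    rw [ha, hb]
  smul_mem' c a ha := by
    simp only [Set.mem_ofPred_eq, Pi.smul_apply, smul_eq_mul, Multiset.sum_map_mul_left] at ha ⊢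
    rw [ha]

theorem Multiset.sum_map_single_one {ι : Type*} [DecidableEq ι] (s : Multiset ι) (i : ι) :
    (s.map (Pi.single i (1 : ℝ) : ι → ℝ)).sum = s.count i := by
  induction s using Multiset.induction_on with
  | empty => simp
  | cons j s ih =>
    rw [Multiset.map_cons, Multiset.sum_cons, ih, Multiset.count_cons, Pi.single_apply]
    push_cast
    simp only [eq_comm (a := i), add_comm]

theorem equalSumSubmodule_ne_top {ι : Type*} {s t : Multiset ι} (hst : s ≠ t) :
    equalSumSubmodule s t ≠ ⊤ := by
  classical
  intro htop
  refine hst (Multiset.ext.2 fun i ↦ ?_)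
  have hi : (Pi.single i (1 : ℝ) : ι → ℝ) ∈ equalSumSubmodule s t := htop ▸ Submodule.mem_top
  change (s.map _).sum = (t.map _).sum at hi
  rw [Multiset.sum_map_single_one, Multiset.sum_map_single_one] at hi
  exact_mod_cast hi

theorem Multiset.exists_map_eq_of_forall_mem_range {ι α : Type*} {f : ι → α} {s : Multiset α}
    (hs : ∀ x ∈ s, x ∈ Set.range f) : ∃ u : Multiset ι, u.map f = s :=
  have : CanLift α ι f (· ∈ Set.range f) := ⟨fun _ hx ↦ hx⟩
  CanLift.prf s hs

theorem almost_all_finite_sets_are_sidon (h k : ℕ) (hh : 0 < h) (hk : 0 < k) :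
    MeasureTheory.volume
      {a : Fin k → ℝ | Function.Injective a ∧ ¬ IsSidonSet h (Set.range a)} = 0 := by
  have hcount : Countable (Multiset (Fin k)) := Quotient.countable
  refine measure_mono_null
    (t := ⋃ p : {p : Multiset (Fin k) × Multiset (Fin k) // p.1 ≠ p.2},
      (equalSumSubmodule p.1.1 p.1.2 : Set (Fin k → ℝ))) ?_
    (measure_iUnion_null fun p ↦ Measure.addHaar_submodule _ _ (equalSumSubmodule_ne_top p.2))
  rintro a ⟨-, ha⟩
  simp only [IsSidonSet, not_forall] at ha
  obtain ⟨s, t, hs, ht, -, -, hsum, hne⟩ := ha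
  obtain ⟨u, rfl⟩ := Multiset.exists_map_eq_of_forall_mem_range hs
  obtain ⟨v, rfl⟩ := Multiset.exists_map_eq_of_forall_mem_range ht
  exact Set.mem_iUnion.2 ⟨⟨(u, v), fun huv ↦ hne (congrArg (Multiset.map a) huv)⟩, hsum⟩
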